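/- If r ∈ ℕ_+ and n ≥ r, then |D_r(n) − (n!/e)·C(n-1, r)| < 2·n!·C(n-1, r-1), where e is Euler's number and C(a,b) denotes the binomial coefficient. -/

import Mathlib

/-- The `r`-derangement number `D_r(n)`: the number of fixed-point-free permutations
of `n + r` elements such that the first `r` (distinguished) elements lie in pairwise
distinct cycles of the cycle decomposition. -/
noncomputable def rDerangement (r n : ℕ) : ℕ :=
  Nat.card {σ : Equiv.Perm (Fin (n + r)) //
    (∀ x, σ x ≠ x) ∧
    ∀ i j : Fin (n + r), (i : ℕ) < r → (j : ℕ) < r → i ≠ j → ¬ σ.SameCycle i j}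

/-- marked points lie in distinct cycles -/
def Good {α : Type} (P : α → Prop) (σ : Equiv.Perm α) : Prop :=
  ∀ i j, P i → P j → σ.SameCycle i j → i = j

theorem Good_permCongr {α β : Type} (e : α ≃ β) (P : β → Prop) (σ : Equiv.Perm α) :
    Good P (e.permCongr σ) ↔ Good (fun a => P (e a)) σ := by
  have key : ∀ a b, (e.permCongr σ).SameCycle (e a) (e b) ↔ σ.SameCycle a b := by
    intro a b
    have hp : ∀ k : ℤ, (e.permCongr σ) ^ k = e.permCongr (σ ^ k) := fun k =>
      (map_zpow (Equiv.permCongrHom e) σ k).symm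
    simp [Equiv.Perm.SameCycle, hp]
  constructor
  · intro h a b ha hb hab
    exact e.injective (h _ _ ha hb ((key a b).2 hab))
  · intro h i j
    obtain ⟨a, rfl⟩ := e.surjective i
    obtain ⟨b, rfl⟩ := e.surjective j
    intro ha hb hab
    rw [h a b ha hb ((key a b).1 hab)]

theorem sameCycle_option {α : Type} [Finite α] [DecidableEq α] (i : Option α)
    (τ : Equiv.Perm α) (a b : α) :
    (Equiv.swap none i * τ.optionCongr).SameCycle (some a) (some b) ↔ τ.SameCycle a b := by
  set σ : Equiv.Perm (Option α) := Equiv.swap none i * τ.optionCongr with hσ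
  have h1 : ∀ c, σ (some c) = if some (τ c) = i then none else some (τ c) := by
    intro c
    simp [hσ, Equiv.swap_apply_def]
  have h0 : σ none = i := by simp [hσ]
  constructor
  · intro h
    obtain ⟨k, hk⟩ := h.exists_nat_pow_eq
    have inv : ∀ k : ℕ, (∃ c, (σ ^ k) (some a) = some c ∧ τ.SameCycle a c) ∨
        ((σ ^ k) (some a) = none ∧ ∃ c, i = some c ∧ τ.SameCycle a c) := by
      intro k
      induction k with
      | zero => left; exact ⟨a, by simp, Equiv.Perm.SameCycle.refl _ _⟩
      | succ k ih =>
        rw [pow_succ', Equiv.Perm.mul_apply]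
        rcases ih with ⟨c, hc, hs⟩ | ⟨hc, c, hi, hs⟩
        · rw [hc, h1]
          have hs' : τ.SameCycle a (τ c) := Equiv.Perm.sameCycle_apply_right.2 hs
          split_ifs with hh
          · right; exact ⟨rfl, τ c, hh.symm, hs'⟩
          · left; exact ⟨τ c, rfl, hs'⟩
        · left; rw [hc, h0]; exact ⟨c, hi, hs⟩
    rcases inv k with ⟨c, hc, hs⟩ | ⟨hc, _⟩
    · rw [hk] at hc; cases hc; exact hs
    · rw [hk] at hc; cases hc
  · intro h
    obtain ⟨k, rfl⟩ := h.exists_nat_pow_eq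
    have step : ∀ c, σ.SameCycle (some c) (some (τ c)) := by
      intro c
      by_cases hh : some (τ c) = i
      · refine ⟨2, ?_⟩
        rw [zpow_two, Equiv.Perm.mul_apply, h1, if_pos hh, h0, hh]
      · refine ⟨1, ?_⟩
        rw [zpow_one, h1, if_neg hh]
    clear h
    induction k with
    | zero => exact Equiv.Perm.SameCycle.refl _ _
    | succ k ih =>
      rw [pow_succ', Equiv.Perm.mul_apply]
      exact ih.trans (step _)

theorem Good_option {α : Type} [Finite α] [DecidableEq α] (P : Option α → Prop) (hP : ¬ P none)
    (i : Option α) (τ : Equiv.Perm α) :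
    Good P (Equiv.swap none i * τ.optionCongr) ↔ Good (fun a => P (some a)) τ := by
  constructor
  · intro h a b ha hb hab
    exact Option.some_injective _ (h _ _ ha hb ((sameCycle_option i τ a b).2 hab))
  · intro h x y hx hy hxy
    cases x with
    | none => exact absurd hx hP
    | some a =>
      cases y with
      | none => exact absurd hy hP
      | some b => rw [h a b hx hy ((sameCycle_option i τ a b).1 hxy)]

theorem card_good (m : ℕ) : ∀ (α : Type) [Finite α] (P : α → Prop),
    Nat.card {x // ¬ P x} = m →
    Nat.card {σ : Equiv.Perm α // Good P σ} * (Nat.card {x // P x}).factorial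
      = (Nat.card α).factorial := by
  classical
  induction m with
  | zero =>
    intro α _ P h
    have hP : ∀ x, P x := by
      intro x
      by_contra hx
      rw [Nat.card_eq_zero] at h
      rcases h with h | h
      · exact h.false ⟨x, hx⟩
      · exact h.not_finite inferInstance
    have e1 : Nat.card {x // P x} = Nat.card α := Nat.card_congr (Equiv.subtypeUnivEquiv hP)
    have e2 : Nat.card {σ : Equiv.Perm α // Good P σ} = 1 := by
      rw [Nat.card_eq_one_iff_unique]
      constructor
      · constructor
        rintro ⟨σ, hs⟩ ⟨τ, ht⟩
        have : ∀ ρ : Equiv.Perm α, Good P ρ → ρ = 1 := by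
          intro ρ hρ
          ext x
          exact (hρ x (ρ x) (hP _) (hP _) ⟨1, by simp⟩).symm
        rw [Subtype.mk.injEq, this σ hs, this τ ht]
      · refine ⟨1, ?_⟩
        rintro i j - - ⟨k, hk⟩
        simpa using hk
    rw [e1, e2, one_mul]
  | succ m ih =>
    intro α _ P h
    have : Nonempty {x // ¬ P x} := by
      by_contra hne
      rw [not_nonempty_iff] at hne
      rw [Nat.card_of_isEmpty] at h
      omega
    obtain ⟨x, hx⟩ := this
    let e : Option {y // y ≠ x} ≃ α := Equiv.optionSubtypeNe x
    have hnone : e none = x := by simp [e]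
    have hsome : ∀ a, e (some a) = a := by intro a; simp [e]
    have c1 : Nat.card {σ : Equiv.Perm α // Good P σ}
        = Nat.card (Option {y // y ≠ x} × {τ : Equiv.Perm {y // y ≠ x} // Good (fun a : {y // y ≠ x} => P a) τ}) := by
      have e1 : {σ : Equiv.Perm (Option {y // y ≠ x}) // Good (fun a => P (e a)) σ} ≃
          {σ : Equiv.Perm α // Good P σ} :=
        Equiv.subtypeEquiv e.permCongr (fun σ => (Good_permCongr e P σ).symm)
      have e2 : {q : Option {y // y ≠ x} × Equiv.Perm {y // y ≠ x} // Good (fun a : {y // y ≠ x} => P a) q.2} ≃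
          {σ : Equiv.Perm (Option {y // y ≠ x}) // Good (fun a => P (e a)) σ} :=
        Equiv.subtypeEquiv Equiv.Perm.decomposeOption.symm (fun q => by
          rw [Equiv.Perm.decomposeOption_symm_apply, Good_option _ (by rw [hnone]; exact hx)]
          simp only [hsome])
      rw [← Nat.card_congr e1, ← Nat.card_congr e2]
      refine Nat.card_congr ⟨fun q => (q.1.1, ⟨q.1.2, q.2⟩), fun q => ⟨(q.1, q.2.1), q.2.2⟩,
        fun _ => rfl, fun _ => rfl⟩
    have c2 : Nat.card α = Nat.card {y // y ≠ x} + 1 := by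
      rw [← Nat.card_congr e, Finite.card_option]
    have c3 : Nat.card {y : {y // y ≠ x} // P y} = Nat.card {y // P y} := by
      refine Nat.card_congr ⟨fun q => ⟨q.1.1, q.2⟩, fun q => ⟨⟨q.1, ?_⟩, q.2⟩,
        fun _ => rfl, fun _ => rfl⟩
      rintro hq
      exact hx (hq ▸ q.2)
    have c4 : Nat.card {y : {y // y ≠ x} // ¬ P y} = m := by
      have e4 : Option {y : {y // y ≠ x} // ¬ P y} ≃ {y // ¬ P y} :=
        { toFun := fun o => o.elim ⟨x, hx⟩ (fun q => ⟨q.1.1, q.2⟩)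
          invFun := fun q => if hq : q.1 = x then none else some ⟨⟨q.1, hq⟩, q.2⟩
          left_inv := by
            rintro (_ | ⟨⟨y, hy⟩, hy'⟩)
            · simp
            · simp [hy]
          right_inv := by
            rintro ⟨y, hy⟩
            by_cases hq : y = x
            · simp [hq]
            · simp [hq] }
      have := Nat.card_congr e4
      rw [Finite.card_option, h] at this
      omega
    have := ih {y // y ≠ x} (fun y => P y) c4
    rw [c3] at this
    rw [c1, c2, Nat.card_prod, Finite.card_option, mul_assoc, this, Nat.factorial_succ]

theorem card_good_fix {α : Type} [Finite α] (P : α → Prop) (T : Finset α) :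
    Nat.card {σ : Equiv.Perm α // Good P σ ∧ ∀ x ∈ T, σ x = x}
      * (Nat.card {x // x ∉ T ∧ P x}).factorial = (Nat.card {x // x ∉ T}).factorial := by
  classical
  have h := card_good _ {x // x ∉ T} (fun x => P x) rfl
  rw [← h]
  have e1 : Nat.card {x : {x // x ∉ T} // P x} = Nat.card {x // x ∉ T ∧ P x} :=
    Nat.card_congr (Equiv.subtypeSubtypeEquivSubtypeInter (fun x => x ∉ T) P)
  rw [e1]
  congr 1
  have e3 : {τ : Equiv.Perm {x // x ∉ T} // Good (fun x : {x // x ∉ T} => P x) τ} ≃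
      {f : {f : Equiv.Perm α // ∀ a, ¬ (a ∉ T) → f a = a} // Good P f.1} := by
    refine (Equiv.subtypeEquiv (Equiv.Perm.subtypeEquivSubtypePerm (fun x => x ∉ T)).symm ?_).symm
    rintro ⟨f, hf⟩
    constructor
    · intro hg a b ha hb hab
      have : f.SameCycle a b := by
        obtain ⟨k, hk⟩ := hab
        refine ⟨k, ?_⟩
        rw [← hk]
        simp [Equiv.Perm.subtypeEquivSubtypePerm]
      exact Subtype.ext (hg _ _ ha hb this)
    · intro hg a b ha hb hab
      by_cases haT : a ∈ T
      · exact hab.eq_of_left (hf a (not_not.2 haT))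
      by_cases hbT : b ∈ T
      · exact hab.eq_of_right (hf b (not_not.2 hbT))
      exact congrArg Subtype.val
        (hg ⟨a, haT⟩ ⟨b, hbT⟩ ha hb (by
          obtain ⟨k, hk⟩ := hab
          refine ⟨k, Subtype.ext ?_⟩
          simpa [Equiv.Perm.subtypeEquivSubtypePerm] using hk))
  rw [Nat.card_congr e3]
  refine Nat.card_congr ⟨fun q => ⟨⟨q.1, fun a ha => q.2.2 a (not_not.1 ha)⟩, q.2.1⟩,
    fun q => ⟨q.1.1, q.2, fun a ha => q.1.2 a (not_not.2 ha)⟩, fun _ => rfl, fun _ => rfl⟩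

theorem incl_excl {α : Type} [Fintype α] [DecidableEq α] (P : α → Prop) :
    (Nat.card {σ : Equiv.Perm α // (∀ x, σ x ≠ x) ∧ Good P σ} : ℤ) =
    ∑ T : Finset α, (-1) ^ T.card *
      (Nat.card {σ : Equiv.Perm α // Good P σ ∧ ∀ x ∈ T, σ x = x} : ℤ) := by
  classical
  simp only [Nat.card_eq_fintype_card, Fintype.card_subtype, Finset.card_filter, Nat.cast_sum,
    Finset.mul_sum]
  rw [Finset.sum_comm]
  refine Finset.sum_congr rfl fun σ _ => ?_
  by_cases hg : Good P σ
  · have := Fintype.prod_add (fun x => -(if σ x = x then (1:ℤ) else 0)) (fun _ => 1)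
    have hl : (∏ x, (-(if σ x = x then (1:ℤ) else 0) + 1)) = if ∀ x, σ x ≠ x then 1 else 0 := by
      split_ifs with h
      · exact Finset.prod_eq_one fun x _ => by simp [h x]
      · push Not at h
        obtain ⟨x, hx⟩ := h
        exact Finset.prod_eq_zero (Finset.mem_univ x) (by simp [hx])
    rw [hl] at this
    simp only [hg, and_true, true_and, Nat.cast_ite, Nat.cast_one, Nat.cast_zero]
    rw [this]
    refine Finset.sum_congr rfl fun T _ => ?_
    rw [Finset.prod_const_one, mul_one, Finset.prod_neg, Finset.prod_boole]
    congr
  · simp [hg]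

theorem diff_id (r m : ℕ) : ∑ i ∈ Finset.range (r + 1),
    (r.choose i : ℤ) * ((-1) ^ i * ((m + (r - i)).choose (r - i) : ℤ)) = m.choose r := by
  have h := fwdDiff_iter_eq_sum_shift (1 : ℕ) (fun x : ℕ => (x.choose m : ℤ)) r m
  rw [← Finset.sum_range_reflect]
  have h2 : (fwdDiff 1)^[r] (fun x : ℕ => (x.choose m : ℤ)) m = m.choose r := by
    rcases le_or_gt r m with hrm | hrm
    · obtain ⟨k, rfl⟩ := Nat.exists_eq_add_of_le hrm
      rw [fwdDiff_iter_choose, Nat.choose_symm_add]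
    · obtain ⟨k, rfl⟩ := Nat.exists_eq_add_of_lt hrm
      rw [Nat.choose_eq_zero_of_lt hrm]
      rw [show m + k + 1 = k + 1 + m by ring, Function.iterate_add_apply,
        show (fwdDiff 1)^[m] (fun x : ℕ => (x.choose m : ℤ)) = fun x => ((x.choose 0 : ℕ) : ℤ) from
          fwdDiff_iter_choose 0 m]
      rw [Function.iterate_succ_apply]
      simp only [Nat.choose_zero_right, Nat.cast_one, fwdDiff_const,
        fwdDiff_iter_eq_sum_shift, smul_zero, Finset.sum_const_zero, Nat.cast_zero]
  rw [← h2, h]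
  refine Finset.sum_congr rfl fun i hi => ?_
  have hi' : i ≤ r := by simpa [Nat.lt_succ_iff] using hi
  have e1 : r + 1 - 1 - i = r - i := by omega
  have e2 : r - (r - i) = i := by omega
  rw [e1, e2, Nat.choose_symm hi', ← Nat.choose_symm_add]
  simp
  ring

theorem card_formula (r n : ℕ) :
    (Nat.card {σ : Equiv.Perm (Fin r ⊕ Fin n) //
      (∀ x, σ x ≠ x) ∧ Good (fun x => x.isLeft = true) σ} : ℤ) =
    ∑ j ∈ Finset.range (n + 1), (n.choose j : ℤ) *
      ((-1) ^ j * ((n - j).factorial * (n - j).choose r)) := by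
  rw [incl_excl, ← Finset.sumEquiv.symm.toEquiv.sum_comp, Fintype.sum_prod_type_right]
  have key : ∀ (A : Finset (Fin r)) (B : Finset (Fin n)),
      (Nat.card {σ : Equiv.Perm (Fin r ⊕ Fin n) // Good (fun x => x.isLeft = true) σ ∧
        ∀ x ∈ A.disjSum B, σ x = x}) =
      (n - B.card).factorial * ((n - B.card) + (r - A.card)).choose (r - A.card) := by
    intro A B
    have h := card_good_fix (fun x : Fin r ⊕ Fin n => x.isLeft = true) (A.disjSum B)
    have c1 : Nat.card {x // x ∉ A.disjSum B} = (n - B.card) + (r - A.card) := by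
      have hA := A.card_le_univ
      have hB := B.card_le_univ
      rw [Nat.card_eq_fintype_card, Fintype.card_subtype_compl]
      simp at *
      omega
    have c2 : Nat.card {x : Fin r ⊕ Fin n // x ∉ A.disjSum B ∧ x.isLeft = true} = r - A.card := by
      have e : {x : Fin r ⊕ Fin n // x ∉ A.disjSum B ∧ x.isLeft = true} ≃ {x // x ∉ A} :=
        { toFun := fun q => ⟨q.1.getLeft q.2.2, by
            obtain ⟨x, h1, h2⟩ := q
            cases x with
            | inl a => simpa using h1
            | inr a => simp at h2⟩
          invFun := fun q => ⟨Sum.inl q.1, by simpa using q.2⟩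
          left_inv := by
            rintro ⟨x, h1, h2⟩
            simp
          right_inv := fun q => rfl }
      rw [Nat.card_congr e, Nat.card_eq_fintype_card, Fintype.card_subtype_compl]
      simp
    rw [c1, c2] at h
    have h3 := Nat.add_choose_mul_factorial_mul_factorial (n - B.card) (r - A.card)
    rw [← h] at h3
    have := Nat.eq_of_mul_eq_mul_right (Nat.factorial_pos _) h3
    rw [← this, mul_comm]
  have h1 : ∀ B : Finset (Fin n), ∑ A : Finset (Fin r),
      ((-1 : ℤ)) ^ (Finset.sumEquiv.symm.toEquiv (A, B)).card *
      (Nat.card {σ : Equiv.Perm (Fin r ⊕ Fin n) // Good (fun x => x.isLeft = true) σ ∧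
        ∀ x ∈ Finset.sumEquiv.symm.toEquiv (A, B), σ x = x} : ℤ) =
      (-1) ^ B.card * ((n - B.card).factorial * (n - B.card).choose r) := by
    intro B
    rw [← diff_id r (n - B.card)]
    have hs := Finset.sum_powerset_apply_card (fun i => (-1 : ℤ) ^ i * (-1) ^ B.card *
      ((n - B.card).factorial * ((n - B.card) + (r - i)).choose (r - i) : ℕ))
      (x := (Finset.univ : Finset (Fin r)))
    rw [Finset.powerset_univ] at hs
    have h2 : ∀ A : Finset (Fin r), Finset.sumEquiv.symm.toEquiv (A, B) = A.disjSum B := fun _ => rfl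
    simp only [h2, key, Finset.card_disjSum, pow_add]
    rw [hs, Finset.card_univ, Fintype.card_fin, Finset.mul_sum, Finset.mul_sum]
    refine Finset.sum_congr rfl fun i _ => ?_
    push_cast
    simp
    ring
  rw [Finset.sum_congr rfl fun B _ => h1 B]
  have hs := Finset.sum_powerset_apply_card (fun i => (-1 : ℤ) ^ i *
      ((n - i).factorial * (n - i).choose r)) (x := (Finset.univ : Finset (Fin n)))
  rw [Finset.powerset_univ] at hs
  rw [hs]
  simp

theorem rDerangement_formula (r n : ℕ) :
    (rDerangement r n : ℤ) = ∑ j ∈ Finset.range (n + 1), (n.choose j : ℤ) *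
      ((-1) ^ j * ((n - j).factorial * (n - j).choose r)) := by
  rw [← card_formula, rDerangement]
  congr 1
  let e : Fin r ⊕ Fin n ≃ Fin (n + r) := finSumFinEquiv.trans (finCongr (add_comm r n))
  have he : ∀ x, ((e x : Fin (n + r)) : ℕ) < r ↔ x.isLeft = true := by
    rintro (x | x)
    · simp [e]
    · simp [e]
  symm
  refine Nat.card_congr (Equiv.subtypeEquiv e.permCongr fun σ => ?_)
  refine and_congr ?_ ?_
  · constructor
    · intro h x hx
      apply h (e.symm x)
      apply e.injective
      simpa using hx
    · intro h x hx
      apply h (e x)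
      simp [hx]
  · have hg : (fun x : Fin r ⊕ Fin n => x.isLeft = true) =
        fun x => (fun y : Fin (n + r) => (y : ℕ) < r) (e x) := by
      funext x; exact propext (he x).symm
    rw [hg, ← Good_permCongr e (fun y : Fin (n + r) => (y : ℕ) < r)]
    constructor
    · intro h i j hi hj hij hs
      exact hij (h i j hi hj hs)
    · intro h i j hi hj hs
      by_contra hij
      exact h i j hi hj hij hs

theorem choose_diff (r n j : ℕ) (hr : 0 < r) (hn : r ≤ n) (hj : 1 ≤ j) :
    (n - j).choose r ≤ (n - 1).choose r ∧
    (n - 1).choose r ≤ (n - j).choose r + (j - 1) * (n - 1).choose (r - 1) := by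
  refine ⟨Nat.choose_le_choose _ (by omega), ?_⟩
  induction j, hj using Nat.le_induction with
  | base => simp
  | succ j hj ih =>
    refine ih.trans ?_
    obtain ⟨s, rfl⟩ := Nat.exists_eq_succ_of_ne_zero hr.ne'
    have hstep : (n - j).choose (s + 1) ≤ (n - (j + 1)).choose (s + 1) + (n - 1).choose s := by
      rcases Nat.lt_or_ge j n with h | h
      · rw [show n - j = (n - (j + 1)) + 1 by omega, Nat.choose_succ_succ']
        have : (n - (j + 1)).choose s ≤ (n - 1).choose s := Nat.choose_le_choose _ (by omega)
        omega
      · rw [show n - j = 0 by omega]; simp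
    obtain ⟨k, rfl⟩ := Nat.exists_eq_add_of_le hj
    simp only [Nat.add_sub_cancel_left, Nat.succ_eq_add_one, Nat.add_sub_cancel,
      show 1 + k + 1 - 1 = k + 1 by omega] at *
    nlinarith

theorem rDerangement_approx (r n : ℕ) (hr : 0 < r) (hn : r ≤ n) :
    |(rDerangement r n : ℝ) -
        (n.factorial : ℝ) / Real.exp 1 * (n - 1).choose r| <
      2 * n.factorial * (n - 1).choose (r - 1) := by
  set K : ℝ := ((n - 1).choose r : ℝ) with hK
  set C : ℝ := ((n - 1).choose (r - 1) : ℝ) with hC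
  have hCpos : 0 < C := by
    rw [hC]; exact_mod_cast Nat.choose_pos (by omega)
  have hnf : (0 : ℝ) < n.factorial := by exact_mod_cast n.factorial_pos
  -- the exact sum
  have hD : HasSum (fun j : ℕ => (-1 : ℝ) ^ j / j.factorial * (n - j).choose r)
      (rDerangement r n / n.factorial) := by
    have h : (rDerangement r n : ℝ) / n.factorial =
        ∑ j ∈ Finset.range (n + 1), (-1 : ℝ) ^ j / j.factorial * (n - j).choose r := by
      have h0 := congrArg (Int.cast : ℤ → ℝ) (rDerangement_formula r n)
      push_cast at h0
      rw [h0, Finset.sum_div]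
      refine Finset.sum_congr rfl fun j hj => ?_
      have hj' : j ≤ n := by simpa [Nat.lt_succ_iff] using hj
      have hc : (n.choose j : ℝ) * j.factorial * (n - j).factorial = n.factorial := by
        exact_mod_cast Nat.choose_mul_factorial_mul_factorial hj'
      have hjf : (j.factorial : ℝ) ≠ 0 := by exact_mod_cast j.factorial_ne_zero
      rw [div_eq_iff hnf.ne', ← hc]
      field_simp
    rw [h]
    refine hasSum_sum_of_ne_finset_zero fun j hj => ?_
    have : n - j = 0 := by simp at hj; omega
    rw [this, Nat.choose_eq_zero_of_lt hr]; simp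
  have hE : HasSum (fun j : ℕ => (-1 : ℝ) ^ j / j.factorial * K) ((Real.exp 1)⁻¹ * K) := by
    rw [← Real.exp_neg]
    have := NormedSpace.expSeries_div_hasSum_exp (-1 : ℝ)
    rw [← Real.exp_eq_exp_ℝ] at this
    exact this.mul_right K
  have hd := hD.sub hE
  -- the majorant
  let b : ℕ → ℝ := fun j => (if j = 0 then 2 else 0) * C + ((j : ℝ) - 1) / j.factorial * C
  have hb : HasSum b (2 * C) := by
    have h1 : HasSum (fun j : ℕ => (1 : ℝ) / j.factorial) (Real.exp 1) := by
      have := NormedSpace.expSeries_div_hasSum_exp (1 : ℝ)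
      rw [← Real.exp_eq_exp_ℝ] at this
      simpa using this
    have h2 : HasSum (fun j : ℕ => (j : ℝ) / j.factorial) (Real.exp 1) := by
      rw [← hasSum_nat_add_iff' 1]
      simp only [Finset.sum_range_one, Nat.cast_zero, zero_div, sub_zero]
      refine h1.congr_fun ?_ |> id
      intro j
      rw [Nat.factorial_succ]
      have hjf : (j.factorial : ℝ) ≠ 0 := by exact_mod_cast j.factorial_ne_zero
      push_cast
      field_simp
    have h3 := (h2.sub h1).mul_right C
    have h4 : HasSum (fun j : ℕ => (if j = 0 then (2 : ℝ) else 0) * C) (2 * C) :=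
      (hasSum_ite_eq 0 (2 : ℝ)).mul_right C
    have h5 := h4.add h3
    simp only [sub_self, zero_mul, add_zero] at h5
    convert h5 using 2 with j
    simp only [b]; ring
  have hle : ∀ j : ℕ, ‖(-1 : ℝ) ^ j / j.factorial * (n - j).choose r -
      (-1 : ℝ) ^ j / j.factorial * K‖ ≤ b j := by
    intro j
    rw [← mul_sub, norm_mul, norm_div, norm_pow, norm_neg, norm_one, one_pow, Real.norm_eq_abs,
      Real.norm_eq_abs, Nat.abs_cast]
    rcases Nat.eq_zero_or_pos j with rfl | hj
    · have hp : ((n.choose r : ℕ) : ℝ) = C + K := by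
        have := Nat.choose_succ_succ (n - 1) (r - 1)
        rw [Nat.succ_eq_add_one, Nat.succ_eq_add_one, Nat.sub_add_cancel hr,
          Nat.sub_add_cancel (hr.trans_le hn)] at this
        rw [hC, hK, this]; push_cast; ring
      simp [b, hp, abs_of_pos hCpos]
      linarith
    · obtain ⟨l, u⟩ := choose_diff r n j hr hn hj
      have l' : ((n - j).choose r : ℝ) ≤ K := by rw [hK]; exact_mod_cast l
      have u' : K ≤ ((n - j).choose r : ℝ) + ((j : ℝ) - 1) * C := by
        have hj1 : ((j - 1 : ℕ) : ℝ) = (j : ℝ) - 1 := by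
          rw [Nat.cast_sub hj, Nat.cast_one]
        rw [hK, hC, ← hj1]; exact_mod_cast u
      simp only [b, hj.ne', if_false, zero_mul, zero_add]
      rw [abs_of_nonpos (by linarith), div_mul_eq_mul_div, div_mul_eq_mul_div]
      refine div_le_div_of_nonneg_right ?_ (Nat.cast_nonneg _)
      linarith
  have hlt : ‖(-1 : ℝ) ^ (n + 2) / (n + 2).factorial * (n - (n + 2)).choose r -
      (-1 : ℝ) ^ (n + 2) / (n + 2).factorial * K‖ < b (n + 2) := by
    rw [← mul_sub, norm_mul, norm_div, norm_pow, norm_neg, norm_one, one_pow, Real.norm_eq_abs,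
      Real.norm_eq_abs, Nat.abs_cast]
    obtain ⟨l, u⟩ := choose_diff r n n hr hn (by omega)
    have hz : n - (n + 2) = 0 := by omega
    have hz' : ((0 : ℕ).choose r) = 0 := Nat.choose_eq_zero_of_lt hr
    have u' : K ≤ ((n : ℝ) - 1) * C := by
      rw [Nat.sub_self, hz', zero_add] at u
      have hj1 : ((n - 1 : ℕ) : ℝ) = (n : ℝ) - 1 := by
        rw [Nat.cast_sub (by omega), Nat.cast_one]
      rw [hK, hC, ← hj1]; exact_mod_cast u
    have hK0 : 0 ≤ K := by positivity
    simp only [b, hz, hz', show n + 2 ≠ 0 by omega, if_false, zero_mul, zero_add]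
    rw [Nat.cast_zero, zero_sub, abs_neg, abs_of_nonneg hK0, div_mul_eq_mul_div,
      div_mul_eq_mul_div]
    have : (0 : ℝ) < (n + 2).factorial := by exact_mod_cast (n + 2).factorial_pos
    refine div_lt_div_of_pos_right ?_ this
    push_cast
    linarith
  have hsn : Summable fun j : ℕ => ‖(-1 : ℝ) ^ j / j.factorial * (n - j).choose r -
      (-1 : ℝ) ^ j / j.factorial * K‖ :=
    Summable.of_nonneg_of_le (fun _ => norm_nonneg _) hle hb.summable
  have hmain : |(rDerangement r n : ℝ) / n.factorial - (Real.exp 1)⁻¹ * K| < 2 * C := by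
    rw [← hd.tsum_eq, ← Real.norm_eq_abs]
    refine (norm_tsum_le_tsum_norm hsn).trans_lt ?_
    rw [← hb.tsum_eq]
    exact hsn.tsum_lt_tsum hle hlt hb.summable
  have hfin : (rDerangement r n : ℝ) - (n.factorial : ℝ) / Real.exp 1 * K =
      n.factorial * ((rDerangement r n : ℝ) / n.factorial - (Real.exp 1)⁻¹ * K) := by
    field_simp
  rw [hfin, abs_mul, abs_of_pos hnf]
  calc _ < (n.factorial : ℝ) * (2 * C) := by gcongr
    _ = _ := by ring
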